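/- Let R be a ring, let (B_i)_{i∈I} be a family of finitely presented left R-modules, let B be the class of left R-modules isomorphic to a direct summand of a finite direct sum of modules from the family (B_i), and set M = ⊕_{i∈I} B_i. Then the following are equivalent: (i) Prod(B*), the class of right R-modules isomorphic to a direct summand of a direct product of character modules of members of B, is a definable subcategory of right R-modules; (ii) M* ≅ ∏_{i∈I} B_i* is Σ-pure-injective; (iii) M is Noetherian as a module over its endomorphism ring End_R(M). -/

import Mathlib

universe u

open MulOpposite DirectSum

noncomputable section

/-- The additive group `ℚ/ℤ`. -/
abbrev RatCircle : Type := AddCircle (1 : ℚ)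

/-- The character group `Hom_ℤ(M, ℚ/ℤ)` of an abelian group `M`. -/
def Character (M : Type u) [AddCommGroup M] : Type u := M →+ RatCircle

namespace Character

instance instAddCommGroup (M : Type u) [AddCommGroup M] : AddCommGroup (Character M) :=
  inferInstanceAs (AddCommGroup (M →+ RatCircle))

instance instFunLike (M : Type u) [AddCommGroup M] : FunLike (Character M) M RatCircle :=
  inferInstanceAs (FunLike (M →+ RatCircle) M RatCircle)

instance instAddMonoidHomClass (M : Type u) [AddCommGroup M] :
    AddMonoidHomClass (Character M) M RatCircle :=
  inferInstanceAs (AddMonoidHomClass (M →+ RatCircle) M RatCircle)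

@[ext] lemma ext {M : Type u} [AddCommGroup M] {f g : Character M}
    (h : ∀ m, f m = g m) : f = g := DFunLike.ext _ _ h

variable {R : Type u} [Ring R]

/-- If `M` is a left `R`-module then `Character M` is a right `R`-module,
via `(f • r) m = f (r • m)`. -/
instance instSMulRight {M : Type u} [AddCommGroup M] [Module R M] :
    SMul Rᵐᵒᵖ (Character M) where
  smul r f :=
    ((f : M →+ RatCircle).comp (DistribMulAction.toAddMonoidHom M r.unop) : M →+ RatCircle)

lemma smul_right_apply {M : Type u} [AddCommGroup M] [Module R M]
    (r : Rᵐᵒᵖ) (f : Character M) (m : M) : (r • f) m = f (r.unop • m) := rfl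

instance moduleRight {M : Type u} [AddCommGroup M] [Module R M] :
    Module Rᵐᵒᵖ (Character M) where
  one_smul f := ext fun m => by rw [smul_right_apply, unop_one, one_smul]
  mul_smul r s f := ext fun m => by
    rw [smul_right_apply, smul_right_apply, smul_right_apply, unop_mul, mul_smul]
  smul_zero r := ext fun m => rfl
  smul_add r f g := ext fun m => rfl
  add_smul r s f := ext fun m => by
    show f ((r + s).unop • m) = f (r.unop • m) + f (s.unop • m)
    rw [unop_add, add_smul, map_add]
  zero_smul f := ext fun m => by
    show f ((0 : Rᵐᵒᵖ).unop • m) = 0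
    rw [unop_zero, zero_smul, map_zero]

/-- If `M` is a right `R`-module then `Character M` is a left `R`-module,
via `(r • f) m = f (m • r)`. -/
instance instSMulLeft {M : Type u} [AddCommGroup M] [Module Rᵐᵒᵖ M] :
    SMul R (Character M) where
  smul r f :=
    ((f : M →+ RatCircle).comp (DistribMulAction.toAddMonoidHom M (op r)) : M →+ RatCircle)

lemma smul_left_apply {M : Type u} [AddCommGroup M] [Module Rᵐᵒᵖ M]
    (r : R) (f : Character M) (m : M) : (r • f) m = f (op r • m) := rfl

instance moduleLeft {M : Type u} [AddCommGroup M] [Module Rᵐᵒᵖ M] :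
    Module R (Character M) where
  one_smul f := ext fun m => by rw [smul_left_apply, op_one, one_smul]
  mul_smul r s f := ext fun m => by
    rw [smul_left_apply, smul_left_apply, smul_left_apply, op_mul, mul_smul]
  smul_zero r := ext fun m => rfl
  smul_add r f g := ext fun m => rfl
  add_smul r s f := ext fun m => by
    show f (op (r + s) • m) = f (op r • m) + f (op s • m)
    rw [op_add, add_smul, map_add]
  zero_smul f := ext fun m => by
    show f (op (0 : R) • m) = 0
    rw [op_zero, zero_smul, map_zero]

end Character

section Defs

variable (A : Type u) [Ring A]

/-- A pure embedding: an injective linear map such that every finite system of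
linear equations with constants in `L` solvable in `M` is solvable in `L`. -/
def IsPureEmbedding {L M : Type u} [AddCommGroup L] [AddCommGroup M]
    [Module A L] [Module A M] (i : L →ₗ[A] M) : Prop :=
  Function.Injective i ∧
    ∀ (m n : ℕ) (r : Matrix (Fin m) (Fin n) A) (l : Fin m → L),
      (∃ x : Fin n → M, ∀ j, (∑ k, r j k • x k) = i (l j)) →
      ∃ y : Fin n → L, ∀ j, (∑ k, r j k • y k) = l j

/-- A module is pure-injective if every pure embedding out of it splits. -/
def IsPureInjective (N : Type u) [AddCommGroup N] [Module A N] : Prop :=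
  ∀ (M : Type u) [AddCommGroup M] [Module A M] (i : N →ₗ[A] M),
    IsPureEmbedding A i → ∃ π : M →ₗ[A] N, π.comp i = LinearMap.id

/-- `N` is (isomorphic to) a direct summand of `N'`. -/
def IsDirectSummand (N N' : Type u) [AddCommGroup N] [AddCommGroup N']
    [Module A N] [Module A N'] : Prop :=
  ∃ (i : N →ₗ[A] N') (π : N' →ₗ[A] N), π.comp i = LinearMap.id

/-- A module is indecomposable if it is nonzero and is not the internal direct sum
of two nonzero submodules. -/
def IsIndecomposable (N : Type u) [AddCommGroup N] [Module A N] : Prop :=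
  (∃ x : N, x ≠ 0) ∧ ∀ U V : Submodule A N, U ≠ ⊥ → V ≠ ⊥ → ¬ IsCompl U V

/-- An injective module: every linear map from a submodule of a module `B` into `E`
extends to `B`. -/
def IsInjectiveModule (E : Type u) [AddCommGroup E] [Module A E] : Prop :=
  ∀ (B : Type u) [AddCommGroup B] [Module A B] (L : Submodule A B) (g : L →ₗ[A] E),
    ∃ h : B →ₗ[A] E, ∀ x : L, h x = g x

/-- A cogenerator: points of any module are separated by maps into `E`. -/
def IsCogenerator (E : Type u) [AddCommGroup E] [Module A E] : Prop :=
  ∀ (X : Type u) [AddCommGroup X] [Module A X] (x : X), x ≠ 0 →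
    ∃ g : X →ₗ[A] E, g x ≠ 0

/-- A class of modules is closed under (arbitrary) direct products. -/
def ProdClosed (C : ModuleCat.{u} A → Prop) : Prop :=
  ∀ (ι : Type u) (f : ι → ModuleCat.{u} A), (∀ i, C (f i)) →
    C (ModuleCat.of A (∀ i, (f i : Type u)))

/-- A class of modules is closed under modules purely embedding into its members. -/
def PureSubClosed (C : ModuleCat.{u} A → Prop) : Prop :=
  ∀ (N M : ModuleCat.{u} A) (i : N →ₗ[A] M), IsPureEmbedding A i → C M → C N

/-- A class of modules is closed under colimits of directed systems. -/
def DirLimClosed (C : ModuleCat.{u} A → Prop) : Prop :=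
  ∀ (ι : Type u) [Preorder ι] [IsDirected ι (· ≤ ·)] [Nonempty ι] [DecidableEq ι]
    (G : ι → Type u) [∀ i, AddCommGroup (G i)] [∀ i, Module A (G i)]
    (f : ∀ i j, i ≤ j → G i →ₗ[A] G j) [DirectedSystem G (fun i j h => f i j h)],
    (∀ i, C (ModuleCat.of A (G i))) → C (ModuleCat.of A (Module.DirectLimit G f))

/-- A definable subcategory: a class of modules (closed under isomorphism) which is closed
under direct products, colimits of directed systems, and pure submodules. -/
def IsDefinable (C : ModuleCat.{u} A → Prop) : Prop :=
  ProdClosed A C ∧ DirLimClosed A C ∧ PureSubClosed A C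

end Defs


/-- `add(B)`: direct summands of finite direct sums of modules from the family `B`. -/
def AddCl {R : Type u} [Ring R] (I : Type u) (B : I → Type u)
    [∀ i, AddCommGroup (B i)] [∀ i, Module R (B i)] : ModuleCat.{u} R → Prop :=
  fun N => ∃ (n : ℕ) (s : Fin n → I), IsDirectSummand R (N : Type u) (∀ k, B (s k))

/-- `Prod(B*)`: direct summands of products of character modules of members of `add(B)`. -/
def ProdBStar {R : Type u} [Ring R] (I : Type u) (B : I → Type u)
    [∀ i, AddCommGroup (B i)] [∀ i, Module R (B i)] : ModuleCat.{u} Rᵐᵒᵖ → Prop :=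
  fun N => ∃ (ι : Type u) (g : ι → ModuleCat.{u} R),
    (∀ j, AddCl I B (g j)) ∧
    IsDirectSummand Rᵐᵒᵖ (N : Type u) (∀ j, Character (g j : Type u))

/-- A positive-primitive formula in one free variable `x` over `A`: the condition that the system
`c k • x = ∑ j, r k j • y j` has a solution `y`. -/
structure PPFormula (A : Type u) where
  /-- The equations. -/
  p : Type
  /-- The bound variables. -/
  q : Type
  fintypeEqs : Fintype p
  fintypeVars : Fintype q
  /-- The coefficients of the free variable. -/
  c : p → A
  /-- The coefficients of the bound variables. -/
  r : p → q → A

namespace PPFormula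

attribute [instance] fintypeEqs fintypeVars

variable {A : Type u} [Ring A]

/-- The subgroup of `N` defined by a positive-primitive formula. -/
def sol (d : PPFormula A) (N : Type*) [AddCommGroup N] [Module A N] : AddSubgroup N where
  carrier := {x | ∃ y : d.q → N, ∀ k, d.c k • x = ∑ j, d.r k j • y j}
  zero_mem' := ⟨0, by simp⟩
  add_mem' := by
    rintro a b ⟨y, hy⟩ ⟨z, hz⟩
    exact ⟨y + z, fun k => by simp [smul_add, Finset.sum_add_distrib, hy, hz]⟩
  neg_mem' := by
    rintro a ⟨y, hy⟩
    exact ⟨-y, fun k => by simp [hy]⟩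

/-- The conjunction of two positive-primitive formulas. -/
def conj (d e : PPFormula A) : PPFormula A where
  p := d.p ⊕ e.p
  q := d.q ⊕ e.q
  fintypeEqs := inferInstance
  fintypeVars := inferInstance
  c := Sum.elim d.c e.c
  r := Sum.elim (fun k => Sum.elim (d.r k) 0) (fun k => Sum.elim 0 (e.r k))

variable {N N' : Type*} [AddCommGroup N] [Module A N] [AddCommGroup N'] [Module A N']

lemma mem_sol {d : PPFormula A} {x : N} :
    x ∈ d.sol N ↔ ∃ y : d.q → N, ∀ k, d.c k • x = ∑ j, d.r k j • y j := Iff.rfl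

lemma sum_conj_inl (d e : PPFormula A) (k : d.p) (y : (d.conj e).q → N) :
    ∑ j, (d.conj e).r (Sum.inl k) j • y j = ∑ j, d.r k j • y (Sum.inl j) :=
  (Fintype.sum_sum_type _).trans (by simp [conj])

lemma sum_conj_inr (d e : PPFormula A) (k : e.p) (y : (d.conj e).q → N) :
    ∑ j, (d.conj e).r (Sum.inr k) j • y j = ∑ j, e.r k j • y (Sum.inr j) :=
  (Fintype.sum_sum_type _).trans (by simp [conj])

lemma sol_conj (d e : PPFormula A) : (d.conj e).sol N = d.sol N ⊓ e.sol N := by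
  ext x
  rw [AddSubgroup.mem_inf, mem_sol, mem_sol, mem_sol]
  constructor
  · rintro ⟨y, hy⟩
    exact ⟨⟨fun j => y (.inl j), fun k => (hy (.inl k)).trans (sum_conj_inl d e k y)⟩,
      ⟨fun j => y (.inr j), fun k => (hy (.inr k)).trans (sum_conj_inr d e k y)⟩⟩
  · rintro ⟨⟨y, hy⟩, z, hz⟩
    refine ⟨Sum.elim y z, ?_⟩
    rintro (k | k)
    · exact (hy k).trans (sum_conj_inl d e k (Sum.elim y z)).symm
    · exact (hz k).trans (sum_conj_inr d e k (Sum.elim y z)).symm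

lemma map_mem_sol {d : PPFormula A} (f : N →ₗ[A] N') {x : N} (hx : x ∈ d.sol N) :
    f x ∈ d.sol N' := by
  obtain ⟨y, hy⟩ := hx
  exact ⟨fun j => f (y j), fun k => by rw [← map_smul, hy, map_sum]; simp⟩

lemma mem_sol_pi {d : PPFormula A} {ι : Type*} {X : ι → Type*} [∀ i, AddCommGroup (X i)]
    [∀ i, Module A (X i)] {x : ∀ i, X i} :
    x ∈ d.sol (∀ i, X i) ↔ ∀ i, x i ∈ d.sol (X i) := by
  refine ⟨fun h i => map_mem_sol (LinearMap.proj i) h, fun h => ?_⟩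
  choose y hy using h
  exact ⟨fun j i => y i j, fun k => funext fun i => by simpa using hy i k⟩

end PPFormula

section PureEmbeddings

variable {A : Type u} [Ring A] {N M : Type u} [AddCommGroup N] [Module A N]
  [AddCommGroup M] [Module A M]

lemma IsPureEmbedding.exists_solution {i : N →ₗ[A] M} (hi : IsPureEmbedding A i)
    {p q : Type*} [Fintype p] [Fintype q] (r : p → q → A) (l : p → N)
    (h : ∃ x : q → M, ∀ j, ∑ k, r j k • x k = i (l j)) :
    ∃ y : q → N, ∀ j, ∑ k, r j k • y k = l j := by
  obtain ⟨x, hx⟩ := h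
  let ep := Fintype.equivFin p
  let eq := Fintype.equivFin q
  obtain ⟨y, hy⟩ := hi.2 _ _ (fun j k => r (ep.symm j) (eq.symm k)) (fun j => l (ep.symm j))
    ⟨fun k => x (eq.symm k), fun j => by
      rw [← hx, ← eq.symm.sum_comp (fun k => r (ep.symm j) k • x k)]⟩
  refine ⟨fun k => y (eq k), fun j => ?_⟩
  have := hy (ep j)
  simp only [Equiv.symm_apply_apply] at this
  rw [← this, ← eq.symm.sum_comp (fun k => r j k • y (eq k))]
  simp

lemma IsPureEmbedding.mem_sol {i : N →ₗ[A] M} (hi : IsPureEmbedding A i) {d : PPFormula A} {x : N}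
    (hx : i x ∈ d.sol M) : x ∈ d.sol N := by
  obtain ⟨y, hy⟩ := hx
  obtain ⟨z, hz⟩ := hi.exists_solution d.r (fun k => d.c k • x) ⟨y, fun k => by simp [hy]⟩
  exact ⟨z, fun k => (hz k).symm⟩

lemma isPureEmbedding_of_leftInverse {i : N →ₗ[A] M} {π : M →ₗ[A] N}
    (h : π.comp i = LinearMap.id) : IsPureEmbedding A i := by
  have h' : ∀ x, π (i x) = x := fun x => LinearMap.congr_fun h x
  refine ⟨Function.LeftInverse.injective h', fun m n r l ⟨x, hx⟩ => ⟨fun k => π (x k), fun j => ?_⟩⟩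
  rw [← h' (l j), ← hx]
  simp

/-- The natural map from a direct sum to the direct product, as a linear map. -/
def directSumToPi (A : Type u) [Ring A] {ι : Type u} (X : ι → Type u) [∀ i, AddCommGroup (X i)]
    [∀ i, Module A (X i)] : (⨁ i, X i) →ₗ[A] ∀ i, X i :=
  LinearMap.pi fun i => DirectSum.component A ι X i

open Classical in
/-- The map from a product to the direct sum keeping only the coordinates in `s`. -/
def truncate (A : Type u) [Ring A] {ι : Type u} (X : ι → Type u) [∀ i, AddCommGroup (X i)]
    [∀ i, Module A (X i)] (s : Finset ι) : (∀ i, X i) →ₗ[A] ⨁ i, X i :=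
  ∑ i ∈ s, (DirectSum.lof A ι X i).comp (LinearMap.proj i)

lemma truncate_apply_of_mem {ι : Type u} (X : ι → Type u) [∀ i, AddCommGroup (X i)]
    [∀ i, Module A (X i)] {s : Finset ι} (x : ∀ i, X i) {i : ι} (hi : i ∈ s) :
    truncate A X s x i = x i := by
  classical
  simp only [truncate, LinearMap.sum_apply, LinearMap.comp_apply, LinearMap.proj_apply]
  rw [DFinsupp.finsetSum_apply]
  simp only [DirectSum.lof_eq_of, DirectSum.of_apply]
  rw [Finset.sum_eq_single i (fun b _ hb => by simp [hb]) (fun h => absurd hi h)]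
  simp

lemma truncate_apply_of_notMem {ι : Type u} (X : ι → Type u) [∀ i, AddCommGroup (X i)]
    [∀ i, Module A (X i)] {s : Finset ι} (x : ∀ i, X i) {i : ι} (hi : i ∉ s) :
    truncate A X s x i = 0 := by
  classical
  simp only [truncate, LinearMap.sum_apply, LinearMap.comp_apply, LinearMap.proj_apply]
  rw [DFinsupp.finsetSum_apply]
  simp only [DirectSum.lof_eq_of, DirectSum.of_apply]
  exact Finset.sum_eq_zero fun b hb => dif_neg (by rintro rfl; exact hi hb)

lemma isPureEmbedding_directSumToPi {ι : Type u} (X : ι → Type u) [∀ i, AddCommGroup (X i)]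
    [∀ i, Module A (X i)] : IsPureEmbedding A (directSumToPi A X) := by
  classical
  refine ⟨fun x y h => DFinsupp.ext fun i => congr_fun h i, fun m n r l ⟨x, hx⟩ => ?_⟩
  let s : Finset ι := Finset.univ.biUnion fun j => DFinsupp.support (l j)
  have hT : ∀ j, truncate A X s (directSumToPi A X (l j)) = l j := by
    intro j
    refine DFinsupp.ext fun i => ?_
    by_cases hi : i ∈ s
    · exact truncate_apply_of_mem X _ hi
    · refine (truncate_apply_of_notMem X _ hi).trans ?_
      by_contra h
      exact hi (Finset.mem_biUnion.2 ⟨j, Finset.mem_univ _, DFinsupp.mem_support_iff.2 (Ne.symm h)⟩)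
  refine ⟨fun k => truncate A X s (x k), fun j => ?_⟩
  rw [← hT j, ← hx]
  simp

/-- The embedding `i` stays pure after passing to the quotient of `M` by `K`. -/
def PureModulo (i : N →ₗ[A] M) (K : Submodule A M) : Prop :=
  ∀ (p q : Type) [Fintype p] [Fintype q] (r : p → q → A) (l : p → N),
    (∃ x : q → M, ∀ j, ∑ k, r j k • x k - i (l j) ∈ K) → ∃ y : q → N, ∀ j, ∑ k, r j k • y k = l j

variable (A N) in
/-- Any family of cosets of pp-definable subgroups that is closed under pairwise intersections (via
conjunctions of the defining formulas) and consists of nonempty sets has a common point. -/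
def IsAlgCompact : Prop :=
  ∀ S : Set (PPFormula A × N),
    (∀ a ∈ S, ∀ b ∈ S, ∃ z, (a.1.conj b.1, z) ∈ S ∧
      z - a.2 ∈ a.1.sol N ∧ z - b.2 ∈ b.1.sol N) →
    ∃ n, ∀ a ∈ S, n - a.2 ∈ a.1.sol N

lemma PureModulo.exists_extension {i : N →ₗ[A] M} {K : Submodule A M} (hK : PureModulo i K)
    (hN : IsAlgCompact A N) (m : M) : ∃ n : N, PureModulo i (K ⊔ Submodule.span A {m - i n}) := by
  have key : ∀ (d : PPFormula A) (l : d.p → N),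
      (∃ x : d.q → M, ∀ j, ∑ k, d.r j k • x k - d.c j • m - i (l j) ∈ K) →
      ∃ (z : N) (y : d.q → N), ∀ j, ∑ k, d.r j k • y k - d.c j • z = l j := by
    rintro d l ⟨x, hx⟩
    obtain ⟨y, hy⟩ := hK d.p (Option d.q) (fun j k => k.elim (-d.c j) (d.r j)) l
      ⟨fun k => k.elim m x, fun j => by
        convert hx j using 1
        simp [Fintype.sum_option]
        abel⟩
    refine ⟨y none, fun k => y (some k), fun j => ?_⟩
    rw [← hy j]
    simp [Fintype.sum_option]
    abel
  let S : Set (PPFormula A × N) := {a | ∃ l : a.1.p → N,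
    (∃ x : a.1.q → M, ∀ j, ∑ k, a.1.r j k • x k - a.1.c j • m - i (l j) ∈ K) ∧
    ∃ y : a.1.q → N, ∀ j, ∑ k, a.1.r j k • y k - a.1.c j • a.2 = l j}
  obtain ⟨n, hn⟩ := hN S (by
    rintro ⟨d, u⟩ ⟨l, ⟨x, hx⟩, y, hy⟩ ⟨e, v⟩ ⟨l', ⟨x', hx'⟩, y', hy'⟩
    dsimp only at *
    have hx'' : ∀ j, ∑ k, (d.conj e).r j k • (Sum.elim x x' : (d.conj e).q → M) k
        - (d.conj e).c j • m - i ((Sum.elim l l' : (d.conj e).p → N) j) ∈ K := by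
      rintro (j | j)
      · exact (congrArg (fun t => t - d.c j • m - i (l j) ∈ K)
          (PPFormula.sum_conj_inl d e j (Sum.elim x x'))).mpr (hx j)
      · exact (congrArg (fun t => t - e.c j • m - i (l' j) ∈ K)
          (PPFormula.sum_conj_inr d e j (Sum.elim x x'))).mpr (hx' j)
    obtain ⟨z, w, hw⟩ := key (d.conj e) (Sum.elim l l') ⟨_, hx''⟩
    refine ⟨z, ⟨_, ⟨_, hx''⟩, w, hw⟩, ⟨fun k => w (.inl k) - y k, fun j => ?_⟩,
      ⟨fun k => w (.inr k) - y' k, fun j => ?_⟩⟩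
    · have h1 := hw (.inl j)
      rw [PPFormula.sum_conj_inl] at h1
      replace h1 : ∑ k, d.r j k • w (.inl k) - d.c j • z = l j := h1
      simp only [smul_sub, Finset.sum_sub_distrib]
      have h2 := hy j
      rw [← h1, sub_eq_sub_iff_add_eq_add] at h2
      rw [sub_eq_sub_iff_add_eq_add, add_comm, ← h2, add_comm]
    · have h1 := hw (.inr j)
      rw [PPFormula.sum_conj_inr] at h1
      replace h1 : ∑ k, e.r j k • w (.inr k) - e.c j • z = l' j := h1
      simp only [smul_sub, Finset.sum_sub_distrib]
      have h2 := hy' j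
      rw [← h1, sub_eq_sub_iff_add_eq_add] at h2
      rw [sub_eq_sub_iff_add_eq_add, add_comm, ← h2, add_comm])
  refine ⟨n, fun p q _ _ r l ⟨x, hx⟩ => ?_⟩
  have hx' : ∀ j, ∃ a : A, ∑ k, r j k • x k - a • m - i (l j - a • n) ∈ K := by
    intro j
    obtain ⟨k, hk, w, hw, h⟩ := Submodule.mem_sup.1 (hx j)
    obtain ⟨a, rfl⟩ := Submodule.mem_span_singleton.1 hw
    refine ⟨a, ?_⟩
    convert hk using 1
    rw [map_sub, map_smul, ← sub_eq_of_eq_add h.symm, smul_sub]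
    abel
  choose a ha using hx'
  let d : PPFormula A := ⟨p, q, inferInstance, inferInstance, a, r⟩
  obtain ⟨z, y, hy⟩ := key d (fun j => l j - a j • n) ⟨x, ha⟩
  obtain ⟨y', hy'⟩ := hn (d, z) ⟨_, ⟨x, ha⟩, y, hy⟩
  refine ⟨y + y', fun j => ?_⟩
  have h1 : ∑ k, r j k • y k - a j • z = l j - a j • n := hy j
  have h2 : a j • (n - z) = ∑ k, r j k • y' k := hy' j
  simp only [Pi.add_apply, smul_add, Finset.sum_add_distrib]
  rw [← h2, sub_eq_iff_eq_add.1 h1, smul_sub]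
  abel

lemma IsPureEmbedding.pureModulo_bot {i : N →ₗ[A] M} (hi : IsPureEmbedding A i) :
    PureModulo i ⊥ := fun _ _ _ _ r l ⟨x, hx⟩ =>
  hi.exists_solution r l ⟨x, fun j => sub_eq_zero.1 (hx j)⟩

lemma pureModulo_sSup {i : N →ₗ[A] M} {c : Set (Submodule A M)} (hc : IsChain (· ≤ ·) c)
    (hne : c.Nonempty) (h : ∀ K ∈ c, PureModulo i K) : PureModulo i (sSup c) := by
  rintro p q _ _ r l ⟨x, hx⟩
  have hd := hc.directedOn
  have : ∀ j, ∃ K : c, ∑ k, r j k • x k - i (l j) ∈ K.1 := fun j => by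
    obtain ⟨K, hK, h⟩ := (Submodule.mem_sSup_of_directed hne hd).1 (hx j)
    exact ⟨⟨K, hK⟩, h⟩
  choose K hK using this
  have : Nonempty c := hne.to_subtype
  obtain ⟨L, hL⟩ := (directedOn_iff_directed.1 hd).finite_le K
  exact h L.1 L.2 p q r l ⟨x, fun j => hL j (hK j)⟩

theorem IsAlgCompact.isPureInjective (hN : IsAlgCompact A N) : IsPureInjective A N := by
  intro M _ _ i hi
  obtain ⟨K, hK⟩ := zorn_le_nonempty₀ {K : Submodule A M | PureModulo i K}
    (fun c hc hchain K hKc => ⟨sSup c, pureModulo_sSup hchain ⟨K, hKc⟩ hc, fun L hL => le_sSup hL⟩)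
    ⊥ hi.pureModulo_bot
  obtain ⟨-, hK⟩ := hK
  have hbij : Function.Bijective (K.mkQ.comp i) := by
    constructor
    · rw [← LinearMap.ker_eq_bot, LinearMap.ker_eq_bot']
      intro n hn
      obtain ⟨y, hy⟩ := hK.prop Unit Empty (fun _ => Empty.elim) (fun _ => n)
        ⟨Empty.elim, fun _ => by simpa using hn⟩
      simpa using (hy ()).symm
    · intro w
      obtain ⟨m, rfl⟩ := K.mkQ_surjective w
      obtain ⟨n, hn⟩ := PureModulo.exists_extension hK.prop hN m
      refine ⟨n, ?_⟩
      have := hK.le_of_ge hn le_sup_left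
        (Submodule.mem_sup_right (Submodule.mem_span_singleton_self _))
      rw [← sub_eq_zero, LinearMap.comp_apply, ← map_sub, ← neg_sub, map_neg, neg_eq_zero]
      exact (Submodule.Quotient.mk_eq_zero K).2 this
  refine ⟨(LinearEquiv.ofBijective _ hbij).symm.toLinearMap.comp K.mkQ, ?_⟩
  ext n
  exact (LinearEquiv.ofBijective _ hbij).symm_apply_apply n

end PureEmbeddings

section CharacterModules

/-- An additive map to `ℚ/ℤ` vanishing on the kernel of `T` factors through `T`. -/
lemma exists_ratCircle_extension {X Y : Type*} [AddCommGroup X] [AddCommGroup Y] (T : X →+ Y)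
    (F : X →+ RatCircle) (h : ∀ x, T x = 0 → F x = 0) :
    ∃ G : Y →+ RatCircle, ∀ x, G (T x) = F x := by
  obtain ⟨G, hG⟩ := (Module.Baer.of_divisible RatCircle).extension_property_addMonoidHom
    (QuotientAddGroup.kerLift T) (QuotientAddGroup.kerLift_injective T)
    (QuotientAddGroup.lift T.ker F h)
  exact ⟨G, fun x => DFunLike.congr_fun hG (x : X ⧸ T.ker)⟩

namespace Character

variable {R : Type u} [Ring R] {X Y : Type u} [AddCommGroup X] [Module R X] [AddCommGroup Y]
  [Module R Y]

/-- Precomposition with a linear map, as a linear map of character modules. -/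
def map (f : X →ₗ[R] Y) : Character Y →ₗ[Rᵐᵒᵖ] Character X where
  toFun g := (g : Y →+ RatCircle).comp f.toAddMonoidHom
  map_add' _ _ := rfl
  map_smul' r g := ext fun x => congrArg g (f.map_smul r.unop x).symm

lemma map_apply (f : X →ₗ[R] Y) (g : Character Y) (x : X) : map f g x = g (f x) := rfl

lemma sum_apply {ι : Type*} (s : Finset ι) (f : ι → Character X) (x : X) :
    (∑ i ∈ s, f i) x = ∑ i ∈ s, f i x :=
  map_sum (AddMonoidHom.eval x : (X →+ RatCircle) →+ RatCircle) f s

lemma exists_separating (U : AddSubgroup X) {x : X} (hx : x ∉ U) :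
    ∃ f : Character X, (∀ y ∈ U, f y = 0) ∧ f x ≠ 0 := by
  have hx' : (x : X ⧸ U) ≠ 0 := fun h => hx ((QuotientAddGroup.eq_zero_iff x).1 h)
  obtain ⟨c, hc⟩ := CharacterModule.exists_character_apply_ne_zero_of_ne_zero hx'
  exact ⟨(c : (X ⧸ U) →+ RatCircle).comp (QuotientAddGroup.mk' U), fun y hy =>
    (congrArg c ((QuotientAddGroup.eq_zero_iff y).2 hy)).trans
      (map_zero (c : (X ⧸ U) →+ RatCircle)), hc⟩

open Classical in
/-- A pp-definable subgroup of a character module is the annihilator of the subgroup defined by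
the dual formula. -/
lemma mem_sol_iff {d : PPFormula Rᵐᵒᵖ} {f : Character X} :
    f ∈ d.sol (Character X) ↔
      ∀ x : d.p → X, (∀ j, ∑ k, (d.r k j).unop • x k = 0) → f (∑ k, (d.c k).unop • x k) = 0 := by
  constructor
  · rintro ⟨y, hy⟩ x hx
    have h1 : ∀ k, f ((d.c k).unop • x k) = ∑ j, y j ((d.r k j).unop • x k) := fun k => by
      rw [← smul_right_apply, hy k, sum_apply]
      rfl
    rw [map_sum, Finset.sum_congr rfl fun k _ => h1 k, Finset.sum_comm]
    refine Finset.sum_eq_zero fun j _ => ?_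
    rw [← map_sum, hx j, map_zero]
  · intro h
    let T : (d.p → X) →+ (d.q → X) := AddMonoidHom.mk'
      (fun x j => ∑ k, (d.r k j).unop • x k)
      (fun x y => funext fun j => by simp [smul_add, Finset.sum_add_distrib])
    let F : (d.p → X) →+ RatCircle := AddMonoidHom.mk'
      (fun x => f (∑ k, (d.c k).unop • x k))
      (fun x y => by simp [smul_add, Finset.sum_add_distrib])
    obtain ⟨G, hG⟩ := exists_ratCircle_extension T F fun x hx => h x fun j => congr_fun hx j
    refine ⟨fun j => (G.comp (AddMonoidHom.single (fun _ => X) j) : X →+ RatCircle),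
      fun k => ext fun x => ?_⟩
    have h1 : F (Pi.single k x) = f ((d.c k).unop • x) := by
      refine congrArg f ?_
      rw [Finset.sum_eq_single k (fun b _ hb => by simp [hb]) (fun h => absurd (Finset.mem_univ _) h)]
      simp
    have h2 : T (Pi.single k x) = ∑ j, Pi.single j ((d.r k j).unop • x) := by
      rw [Finset.univ_sum_single]
      funext j
      show ∑ k', (d.r k' j).unop • (Pi.single k x : d.p → X) k' = _
      rw [Finset.sum_eq_single k (fun b _ hb => by simp [hb]) (fun h => absurd (Finset.mem_univ _) h)]
      simp
    rw [smul_right_apply, ← h1, ← hG, h2, map_sum, sum_apply]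
    rfl

/-- The elements of `X` annihilated by all members of a subgroup of `Character X`. -/
def preannihilator (V : AddSubgroup (Character X)) : AddSubgroup X where
  carrier := {x | ∀ f ∈ V, f x = 0}
  zero_mem' _ _ := map_zero _
  add_mem' ha hb f hf := by rw [map_add, ha f hf, hb f hf, add_zero]
  neg_mem' ha f hf := by rw [map_neg, ha f hf, neg_zero]

lemma mem_sol_of_preannihilator {d : PPFormula Rᵐᵒᵖ} {f : Character X}
    (hf : ∀ x ∈ preannihilator (d.sol (Character X)), f x = 0) : f ∈ d.sol (Character X) :=
  mem_sol_iff.2 fun x hx => hf _ fun _ hg => mem_sol_iff.1 hg x hx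

lemma preannihilator_anti {V W : AddSubgroup (Character X)} (h : V ≤ W) :
    preannihilator W ≤ preannihilator V := fun _ hx f hf => hx f (h hf)

variable (R X) in
theorem isAlgCompact : IsAlgCompact Rᵐᵒᵖ (Character X) := by
  intro S hS
  let P : PPFormula Rᵐᵒᵖ × Character X → (X →ₗ.[ℤ] RatCircle) := fun a =>
    ⟨(preannihilator (a.1.sol (Character X))).toIntSubmodule,
      (a.2 : X →+ RatCircle).toIntLinearMap.comp (Submodule.subtype _)⟩
  have hP : ∀ a b : PPFormula Rᵐᵒᵖ × Character X, b.1.sol (Character X) ≤ a.1.sol _ →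
      b.2 - a.2 ∈ a.1.sol _ → P a ≤ P b := by
    intro a b hba h
    refine ⟨preannihilator_anti hba, ?_⟩
    rintro ⟨x, hx⟩ ⟨y, hy⟩ (rfl : x = y)
    exact (sub_eq_zero.1 (hx _ h)).symm
  have hd : DirectedOn (· ≤ ·) (P '' S) := by
    rintro _ ⟨a, ha, rfl⟩ _ ⟨b, hb, rfl⟩
    obtain ⟨z, hz, h1, h2⟩ := hS a ha b hb
    have hle := PPFormula.sol_conj (N := Character X) a.1 b.1
    exact ⟨_, ⟨_, hz, rfl⟩, hP a _ (hle.le.trans inf_le_left) h1,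
      hP b _ (hle.le.trans inf_le_right) h2⟩
  let Q := LinearPMap.sSup _ hd
  obtain ⟨G, hG⟩ := exists_ratCircle_extension Q.domain.subtype.toAddMonoidHom
    Q.toFun.toAddMonoidHom fun x hx => by
      rw [show x = 0 from Subtype.ext hx]
      exact map_zero _
  refine ⟨G, fun a ha => mem_sol_of_preannihilator fun x hx => ?_⟩
  have hle := LinearPMap.le_sSup hd ⟨a, ha, rfl⟩
  have h1 : G x = Q ⟨x, hle.1 hx⟩ := hG ⟨x, hle.1 hx⟩
  have h2 : P a ⟨x, hx⟩ = Q ⟨x, hle.1 hx⟩ := hle.2 rfl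
  exact sub_eq_zero.2 (h1.trans h2.symm)

/-- The character module of a direct sum is the product of the character modules. -/
def directSumEquiv {I : Type u} (B : I → Type u) [∀ i, AddCommGroup (B i)] [∀ i, Module R (B i)]
    [DecidableEq I] : Character (⨁ i, B i) ≃ₗ[Rᵐᵒᵖ] ∀ i, Character (B i) :=
  LinearEquiv.ofBijective (LinearMap.pi fun i => map (DirectSum.lof R I B i)) (by
    constructor
    · intro f g h
      exact DirectSum.addHom_ext' fun i => congr_fun h i
    · intro g
      refine ⟨(DirectSum.toAddMonoid fun i => (g i : B i →+ RatCircle)), funext fun i => ext fun x => ?_⟩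
      exact DirectSum.toAddMonoid_of (fun i => (g i : B i →+ RatCircle)) i x)

end Character

end CharacterModules

section ChainConditions

variable {A : Type u} [Ring A] {N N' N₀ : Type u} [AddCommGroup N] [Module A N]
  [AddCommGroup N'] [Module A N'] [AddCommGroup N₀] [Module A N₀]

lemma IsDirectSummand.trans (h : IsDirectSummand A N N') (h' : IsDirectSummand A N' N₀) :
    IsDirectSummand A N N₀ := by
  obtain ⟨i, π, h⟩ := h
  obtain ⟨i', π', h'⟩ := h'
  refine ⟨i'.comp i, π.comp π', ?_⟩
  rw [LinearMap.comp_assoc, ← LinearMap.comp_assoc i, h', LinearMap.id_comp, h]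

lemma IsAlgCompact.of_isDirectSummand (hN' : IsAlgCompact A N') (h : IsDirectSummand A N N') :
    IsAlgCompact A N := by
  obtain ⟨i, π, h⟩ := h
  have h' : ∀ x, π (i x) = x := fun x => LinearMap.congr_fun h x
  intro S hS
  obtain ⟨n, hn⟩ := hN' ((fun a : PPFormula A × N => (a.1, i a.2)) '' S) (by
    rintro _ ⟨a, ha, rfl⟩ _ ⟨b, hb, rfl⟩
    obtain ⟨z, hz, h1, h2⟩ := hS a ha b hb
    exact ⟨i z, ⟨_, hz, rfl⟩, by simpa using PPFormula.map_mem_sol i h1,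
      by simpa using PPFormula.map_mem_sol i h2⟩)
  refine ⟨π n, fun a ha => ?_⟩
  simpa [h'] using PPFormula.map_mem_sol π (hn _ ⟨a, ha, rfl⟩)

lemma IsAlgCompact.pi {ι : Type u} {X : ι → Type u} [∀ i, AddCommGroup (X i)]
    [∀ i, Module A (X i)] (h : ∀ i, IsAlgCompact A (X i)) : IsAlgCompact A (∀ i, X i) := by
  intro S hS
  have : ∀ i, ∃ n : X i, ∀ a ∈ S, n - a.2 i ∈ a.1.sol (X i) := fun i => by
    obtain ⟨n, hn⟩ := h i ((fun a : PPFormula A × (∀ i, X i) => (a.1, a.2 i)) '' S) (by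
      rintro _ ⟨a, ha, rfl⟩ _ ⟨b, hb, rfl⟩
      obtain ⟨z, hz, h1, h2⟩ := hS a ha b hb
      exact ⟨z i, ⟨_, hz, rfl⟩, PPFormula.mem_sol_pi.1 h1 i, PPFormula.mem_sol_pi.1 h2 i⟩)
    exact ⟨n, fun a ha => hn _ ⟨a, ha, rfl⟩⟩
  choose n hn using this
  exact ⟨n, fun a ha => PPFormula.mem_sol_pi.2 fun i => hn i a ha⟩

variable (A N) in
/-- The descending chain condition on pp-definable subgroups: every nonempty conjunction-closed set
of formulas has a strongest member on `N`. -/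
def PPDescending : Prop :=
  ∀ S : Set (PPFormula A), S.Nonempty → (∀ d ∈ S, ∀ e ∈ S, d.conj e ∈ S) →
    ∃ d ∈ S, ∀ e ∈ S, d.sol N ≤ e.sol N

lemma PPDescending.isAlgCompact (h : PPDescending A N) : IsAlgCompact A N := by
  intro S hS
  rcases S.eq_empty_or_nonempty with rfl | hne
  · exact ⟨0, by simp⟩
  obtain ⟨_, ⟨⟨d, x⟩, hd, rfl⟩, hmin⟩ := h (Prod.fst '' S) (hne.image _) (by
    rintro _ ⟨a, ha, rfl⟩ _ ⟨b, hb, rfl⟩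
    obtain ⟨z, hz, -⟩ := hS a ha b hb
    exact ⟨_, hz, rfl⟩)
  refine ⟨x, fun b hb => ?_⟩
  obtain ⟨z, -, h1, h2⟩ := hS _ hd b hb
  have := sub_mem h2 (hmin _ ⟨b, hb, rfl⟩ h1)
  simpa using this

/-- Every inclusion between pp-definable subgroups that holds on `N₀` also holds on `N`. -/
def PPControls (A : Type u) [Ring A] (N₀ N : Type u) [AddCommGroup N₀] [Module A N₀]
    [AddCommGroup N] [Module A N] : Prop :=
  ∀ d e : PPFormula A, d.sol N₀ ≤ e.sol N₀ → d.sol N ≤ e.sol N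

lemma PPDescending.of_ppControls (h : PPDescending A N₀) (h' : PPControls A N₀ N) :
    PPDescending A N := fun S hne hS =>
  let ⟨d, hd, hmin⟩ := h S hne hS
  ⟨d, hd, fun e he => h' d e (hmin e he)⟩

lemma PPControls.of_isPureEmbedding (h : PPControls A N₀ N') {i : N →ₗ[A] N'}
    (hi : IsPureEmbedding A i) : PPControls A N₀ N := fun d e hde _ hx =>
  hi.mem_sol (h d e hde (PPFormula.map_mem_sol i hx))

lemma PPControls.pi {ι : Type u} {X : ι → Type u} [∀ i, AddCommGroup (X i)]
    [∀ i, Module A (X i)] (h : ∀ i, PPControls A N₀ (X i)) : PPControls A N₀ (∀ i, X i) :=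
  fun d e hde _ hx => PPFormula.mem_sol_pi.2 fun i => h i d e hde (PPFormula.mem_sol_pi.1 hx i)

end ChainConditions

section EndNoetherian

variable {R : Type u} [Ring R]

lemma ppDescending_of_isNoetherian {M : Type u} [AddCommGroup M] [Module R M]
    (h : IsNoetherian (Module.End R M) M) : PPDescending Rᵐᵒᵖ (Character M) := by
  intro S hne hS
  let P : PPFormula Rᵐᵒᵖ → Submodule (Module.End R M) M := fun d =>
    { Character.preannihilator (d.sol (Character M)) with
      smul_mem' := fun s _ hx f hf => hx _ (PPFormula.map_mem_sol (Character.map s) hf) }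
  obtain ⟨_, ⟨d, hd, rfl⟩, hmax⟩ := set_has_maximal_iff_noetherian.mpr h (P '' S) (hne.image _)
  refine ⟨d, hd, fun e he f hf => Character.mem_sol_of_preannihilator fun x hx => ?_⟩
  have hle := PPFormula.sol_conj (N := Character M) d e
  have h1 : P d ≤ P (d.conj e) := Character.preannihilator_anti (hle.le.trans inf_le_left)
  have h2 : P e ≤ P (d.conj e) := Character.preannihilator_anti (hle.le.trans inf_le_right)
  have h3 : P d = P (d.conj e) := h1.eq_of_not_lt (hmax _ ⟨_, hS d hd e he, rfl⟩)
  exact (h3.ge (h2 hx) : x ∈ P d) f hf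

/-- If `x` lies in a finitely presented direct summand `P` of `M`, then the annihilator in
`Character M` of the `End M`-submodule generated by `x` is pp-definable. -/
lemma exists_ppFormula_annihilator {M P : Type u} [AddCommGroup M] [Module R M] [AddCommGroup P]
    [Module R P] [Module.FinitePresentation R P] {i : P →ₗ[R] M} {π : M →ₗ[R] P}
    (h : π.comp i = LinearMap.id) (x : P) :
    ∃ d : PPFormula Rᵐᵒᵖ, ∀ f : Character M,
      f ∈ d.sol (Character M) ↔ ∀ s : Module.End R M, f (s (i x)) = 0 := by
  classical
  obtain ⟨n, m, φ, g, hφ, hg⟩ := Module.FinitePresentation.exists_fin' R P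
  obtain ⟨a, rfl⟩ := hφ x
  refine ⟨⟨Fin n, Fin m, inferInstance, inferInstance, fun k => op (a k),
    fun k j => op (g (Pi.single j 1) k)⟩, fun f => Character.mem_sol_iff.trans ⟨?_, ?_⟩⟩
  · intro hf s
    let ψ : (Fin n → R) →ₗ[R] M := (s.comp i).comp φ
    have hψ : ∀ b : Fin n → R, ∑ k, b k • ψ (Pi.single k 1) = ψ b := fun b => by
      conv_rhs => rw [← Finset.univ_sum_single b, map_sum]
      refine Finset.sum_congr rfl fun k _ => ?_
      rw [← map_smul, ← Pi.single_smul, smul_eq_mul, mul_one]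
    have := hf (fun k => ψ (Pi.single k 1)) fun j => (hψ _).trans (by
      show s (i (φ (g _))) = 0
      rw [hg.apply_apply_eq_zero, map_zero, map_zero])
    exact (congrArg f (hψ a)).symm.trans this
  · intro hf y hy
    let ψ : (Fin n → R) →ₗ[R] M := Fintype.linearCombination R y
    have hψg : ψ.comp g = 0 := by
      refine LinearMap.pi_ext' fun j => LinearMap.ext_ring ?_
      exact hy j
    have hker : LinearMap.ker φ ≤ LinearMap.ker ψ := fun b hb => by
      obtain ⟨c, rfl⟩ := (hg b).1 hb
      exact LinearMap.congr_fun hψg c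
    let χ : P →ₗ[R] M := ((LinearMap.ker φ).liftQ ψ hker).comp
      (φ.quotKerEquivOfSurjective hφ).symm.toLinearMap
    have hχ : χ (φ a) = ψ a := by
      have : (φ.quotKerEquivOfSurjective hφ).symm (φ a) = (LinearMap.ker φ).mkQ a := by
        rw [LinearEquiv.symm_apply_eq]
        rfl
      show (LinearMap.ker φ).liftQ ψ hker ((φ.quotKerEquivOfSurjective hφ).symm (φ a)) = _
      rw [this]
      rfl
    have := hf (χ.comp π)
    rw [LinearMap.comp_apply, show π (i (φ a)) = φ a from LinearMap.congr_fun h _, hχ] at this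
    exact this

lemma exists_ppFormula_annihilator_directSum {I : Type u} {B : I → Type u}
    [∀ i, AddCommGroup (B i)] [∀ i, Module R (B i)]
    (hfp : ∀ i, Module.FinitePresentation R (B i)) (x : ⨁ i, B i) :
    ∃ d : PPFormula Rᵐᵒᵖ, ∀ f : Character (⨁ i, B i),
      f ∈ d.sol (Character (⨁ i, B i)) ↔ ∀ s : Module.End R (⨁ i, B i), f (s x) = 0 := by
  classical
  let F : Finset I := DFinsupp.support x
  let ρ : (⨁ i, B i) →ₗ[R] ∀ i : F, B i := LinearMap.pi fun i => DirectSum.component R I B i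
  let e : (∀ i : F, B i) →ₗ[R] ∀ i, B i :=
    LinearMap.pi fun i => if h : i ∈ F then LinearMap.proj (⟨i, h⟩ : F) else 0
  have he : ∀ (z : ∀ i : F, B i) (i : F), e z i = z i := fun z i => by
    simp only [e, LinearMap.pi_apply]
    rw [dif_pos i.2]
    rfl
  have hρ : ρ.comp ((truncate R B F).comp e) = LinearMap.id :=
    LinearMap.ext fun z => funext fun i => (truncate_apply_of_mem B _ i.2).trans (he z i)
  have hx : truncate R B F (e (ρ x)) = x := DFinsupp.ext fun i => by
    by_cases hi : i ∈ F
    · exact (truncate_apply_of_mem B _ hi).trans (he _ ⟨i, hi⟩)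
    · exact (truncate_apply_of_notMem B _ hi).trans (DFinsupp.notMem_support_iff.1 hi).symm
  obtain ⟨d, hd⟩ := exists_ppFormula_annihilator hρ (ρ x)
  refine ⟨d, fun f => (hd f).trans ?_⟩
  rw [LinearMap.comp_apply, hx]

theorem isNoetherian_of_isPureInjective {I : Type u} {B : I → Type u}
    [∀ i, AddCommGroup (B i)] [∀ i, Module R (B i)]
    (hfp : ∀ i, Module.FinitePresentation R (B i))
    (h : IsPureInjective Rᵐᵒᵖ (⨁ _ : ULift.{u} ℕ, Character (⨁ i, B i))) :
    IsNoetherian (Module.End R (⨁ i, B i)) (⨁ i, B i) := by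
  classical
  set M := ⨁ i, B i
  rw [isNoetherian_iff']
  refine ⟨wellFounded_iff_isEmpty_descending_chain.2 ⟨fun ⟨U, hU⟩ => ?_⟩⟩
  have hmono : Monotone U := monotone_nat_of_le_succ fun n => (hU n).le
  choose x hxU hx using fun n => SetLike.exists_of_lt (hU n)
  choose f hfU hfx using fun n =>
    Character.exists_separating (U n).toAddSubgroup (hx n)
  let X : ULift.{u} ℕ → Type u := fun _ => Character M
  obtain ⟨π, hπ⟩ := h _ _ (isPureEmbedding_directSumToPi (A := Rᵐᵒᵖ) X)
  let a : ∀ k, X k := fun k => f k.down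
  obtain ⟨n, hn⟩ := Infinite.exists_notMem_finset (DFinsupp.support (π a))
  let ρ : (∀ k, X k) →ₗ[Rᵐᵒᵖ] Character M := (DirectSum.component Rᵐᵒᵖ _ X n).comp π
  let s : Finset (ULift.{u} ℕ) := (Finset.range (n.down + 1)).image ULift.up
  have hs : ∀ k, k ∈ s ↔ k.down ≤ n.down := fun k => by
    simp only [s, Finset.mem_image, Finset.mem_range, Nat.lt_succ_iff]
    exact ⟨fun ⟨_, h, e⟩ => e ▸ h, fun h => ⟨_, h, rfl⟩⟩
  let b := truncate Rᵐᵒᵖ X s a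
  have h1 : ρ a = 0 := DFinsupp.notMem_support_iff.1 hn
  have h2 : ρ (directSumToPi Rᵐᵒᵖ X b) = f n.down := by
    have : π (directSumToPi Rᵐᵒᵖ X b) = b := LinearMap.congr_fun hπ b
    show π (directSumToPi Rᵐᵒᵖ X b) n = _
    rw [this]
    exact truncate_apply_of_mem X a ((hs n).2 le_rfl)
  obtain ⟨d, hd⟩ := exists_ppFormula_annihilator_directSum hfp (x n.down)
  have h3 : a - directSumToPi Rᵐᵒᵖ X b ∈ d.sol (∀ k, X k) := by
    refine PPFormula.mem_sol_pi.2 fun k => ?_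
    by_cases hk : k ∈ s
    · have : (a - directSumToPi Rᵐᵒᵖ X b) k = 0 :=
        sub_eq_zero.2 (truncate_apply_of_mem X a hk).symm
      rw [this]
      exact zero_mem _
    · have : (a - directSumToPi Rᵐᵒᵖ X b) k = f k.down :=
        (congrArg (fun t => a k - t) (truncate_apply_of_notMem X a hk)).trans (sub_zero _)
      rw [this, hd]
      intro t
      refine hfU _ _ ((U k.down).smul_mem t (hmono ?_ (hxU n.down)))
      have := mt (hs k).2 hk
      omega
  have h4 := (hd _).1 (PPFormula.map_mem_sol ρ h3) 1
  rw [map_sub, h1, h2, zero_sub] at h4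
  exact hfx n.down (neg_eq_zero.1 h4)

end EndNoetherian

section ProdBStarClosure

lemma isDirectSummand_of_pure_ker {A : Type u} [Ring A] {X Y : Type u} [AddCommGroup X]
    [Module A X] [AddCommGroup Y] [Module A Y] {φ : X →ₗ[A] Y} (hφ : Function.Surjective φ)
    (hK : IsPureInjective A (LinearMap.ker φ))
    (hpure : IsPureEmbedding A (LinearMap.ker φ).subtype) : IsDirectSummand A Y X := by
  obtain ⟨ρ, hρ⟩ := hK X _ hpure
  let σ : X →ₗ[A] X := LinearMap.id - (LinearMap.ker φ).subtype.comp ρ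
  have hσ : LinearMap.ker φ ≤ LinearMap.ker σ := fun x hx => by
    have : ρ x = ⟨x, hx⟩ := LinearMap.congr_fun hρ ⟨x, hx⟩
    simp [σ, this]
  refine ⟨((LinearMap.ker φ).liftQ σ hσ).comp (φ.quotKerEquivOfSurjective hφ).symm.toLinearMap, φ,
    LinearMap.ext fun y => ?_⟩
  obtain ⟨x, rfl⟩ := hφ y
  have h1 : (φ.quotKerEquivOfSurjective hφ).symm (φ x) = (LinearMap.ker φ).mkQ x := by
    rw [LinearEquiv.symm_apply_eq]
    rfl
  have h2 : φ (ρ x) = 0 := (ρ x).2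
  show φ ((LinearMap.ker φ).liftQ σ hσ ((φ.quotKerEquivOfSurjective hφ).symm (φ x))) = φ x
  rw [h1]
  show φ (x - ρ x) = φ x
  rw [map_sub, h2, sub_zero]

/-- The canonical map from the direct sum of a directed system to its direct limit. -/
def directSumToDirectLimit (A : Type u) [Ring A] {ι : Type u} [Preorder ι] [DecidableEq ι]
    (G : ι → Type u) [∀ i, AddCommGroup (G i)] [∀ i, Module A (G i)]
    (f : ∀ i j, i ≤ j → G i →ₗ[A] G j) : (⨁ i, G i) →ₗ[A] Module.DirectLimit G f :=
  DirectSum.toModule A ι _ (Module.DirectLimit.of A ι G f)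

lemma directSumToDirectLimit_lof {A : Type u} [Ring A] {ι : Type u} [Preorder ι] [DecidableEq ι]
    {G : ι → Type u} [∀ i, AddCommGroup (G i)] [∀ i, Module A (G i)]
    {f : ∀ i j, i ≤ j → G i →ₗ[A] G j} (i : ι) (x : G i) :
    directSumToDirectLimit A G f (DirectSum.lof A ι G i x) = Module.DirectLimit.of A ι G f i x :=
  DirectSum.toModule_lof A i x

section DirectLimit

variable {A : Type u} [Ring A] {ι : Type u} [Preorder ι] [IsDirected ι (· ≤ ·)] [Nonempty ι]
  [DecidableEq ι] {G : ι → Type u} [∀ i, AddCommGroup (G i)] [∀ i, Module A (G i)]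
  {f : ∀ i j, i ≤ j → G i →ₗ[A] G j}

lemma directSumToDirectLimit_surjective : Function.Surjective (directSumToDirectLimit A G f) := by
  intro z
  obtain ⟨i, x, rfl⟩ := Module.DirectLimit.exists_of z
  exact ⟨DirectSum.lof A ι G i x, directSumToDirectLimit_lof i x⟩

/-- Finitely many elements of a direct limit come from a common stage. -/
lemma exists_common_stage {n : ℕ} (x : Fin n → Module.DirectLimit G f) :
    ∃ (t : ι) (z : Fin n → G t), ∀ k, Module.DirectLimit.of A ι G f t (z k) = x k := by
  choose i w hw using fun k => Module.DirectLimit.exists_of (x k)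
  obtain ⟨t, ht⟩ := Finite.exists_le i
  exact ⟨t, fun k => f _ _ (ht k) (w k), fun k => by rw [Module.DirectLimit.of_f, hw]⟩

lemma isPureEmbedding_ker_directSumToDirectLimit [DirectedSystem G (fun i j h => f i j h)] :
    IsPureEmbedding A (LinearMap.ker (directSumToDirectLimit A G f)).subtype := by
  refine ⟨Subtype.val_injective, fun m n r l ⟨x, hx⟩ => ?_⟩
  obtain ⟨t, z, hz⟩ := exists_common_stage fun k => directSumToDirectLimit A G f (x k)
  have h0 : ∀ j, Module.DirectLimit.of A ι G f t (∑ k, r j k • z k) = 0 := fun j => by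
    have := congrArg (directSumToDirectLimit A G f) (hx j)
    rw [map_sum] at this ⊢
    simp only [map_smul] at this ⊢
    simp only [hz]
    exact this.trans (l j).2
  choose u htu hu using fun j => Module.DirectLimit.of.zero_exact (h0 j)
  obtain ⟨v₀, hv₀⟩ := Finite.exists_le u
  obtain ⟨v, hv₀v, htv⟩ := exists_ge_ge v₀ t
  have huv : ∀ j, u j ≤ v := fun j => (hv₀ j).trans hv₀v
  have hv : ∀ j, ∑ k, r j k • f t v htv (z k) = 0 := fun j => by
    have h1 := congrArg (f (u j) v (huv j)) (hu j)
    rw [map_zero, DirectedSystem.map_map' (f := fun i j h => f i j h)] at h1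
    simpa using h1
  refine ⟨fun k => ⟨x k - DirectSum.lof A ι G v (f t v htv (z k)), ?_⟩, fun j => Subtype.ext ?_⟩
  · rw [LinearMap.mem_ker, map_sub, directSumToDirectLimit_lof, Module.DirectLimit.of_f, hz,
      sub_self]
  · have h1 := congrArg (DirectSum.lof A ι G v) (hv j)
    rw [map_sum, map_zero] at h1
    simp only [map_smul] at h1
    have h2 : ∑ k, r j k • x k = l j := hx j
    simp [smul_sub, h1, h2]

end DirectLimit

variable {R : Type u} [Ring R] {I : Type u} {B : I → Type u} [∀ i, AddCommGroup (B i)]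
  [∀ i, Module R (B i)]

lemma ProdBStar.of_isDirectSummand {N X : ModuleCat.{u} Rᵐᵒᵖ} (hX : ProdBStar I B X)
    (h : IsDirectSummand Rᵐᵒᵖ N X) : ProdBStar I B N := by
  obtain ⟨ι, g, hg, hX⟩ := hX
  exact ⟨ι, g, hg, h.trans hX⟩

lemma ProdBStar.isAlgCompact {N : ModuleCat.{u} Rᵐᵒᵖ} (h : ProdBStar I B N) :
    IsAlgCompact Rᵐᵒᵖ N := by
  obtain ⟨ι, g, -, h⟩ := h
  exact (IsAlgCompact.pi fun j => Character.isAlgCompact R (g j)).of_isDirectSummand h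

lemma AddCl.ppControls {g : ModuleCat.{u} R} (h : AddCl I B g) :
    PPControls Rᵐᵒᵖ (Character (⨁ i, B i)) (Character g) := by
  classical
  obtain ⟨n, s, α, β, hβα⟩ := h
  intro d e hde f hf
  have hsum : f = ∑ k, Character.map ((LinearMap.proj k).comp α)
      (Character.map (β.comp (LinearMap.single R (fun k => B (s k)) k)) f) := by
    refine Character.ext fun x => ?_
    rw [Character.sum_apply]
    simp only [Character.map_apply, LinearMap.comp_apply, LinearMap.proj_apply]
    rw [← map_sum, ← map_sum]
    have h1 : ∑ k, LinearMap.single R (fun k => B (s k)) k (α x k) = α x :=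
      Finset.univ_sum_single (α x)
    have h2 : β (α x) = x := LinearMap.congr_fun hβα x
    rw [h1, h2]
  rw [hsum]
  refine sum_mem fun k _ => PPFormula.map_mem_sol _ ?_
  set φ := Character.map (β.comp (LinearMap.single R (fun k => B (s k)) k)) f
  have hφ : φ ∈ d.sol (Character (B (s k))) := PPFormula.map_mem_sol _ hf
  have h1 := hde (PPFormula.map_mem_sol (Character.map (DirectSum.component R I B (s k))) hφ)
  have h2 := PPFormula.map_mem_sol (Character.map (DirectSum.lof R I B (s k))) h1
  convert h2 using 1
  refine Character.ext fun x => ?_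
  exact (congrArg φ (DirectSum.component.lof_self R (s k) x)).symm

lemma ProdBStar.ppControls {N : ModuleCat.{u} Rᵐᵒᵖ} (h : ProdBStar I B N) :
    PPControls Rᵐᵒᵖ (Character (⨁ i, B i)) N := by
  obtain ⟨ι, g, hg, i, π, hπ⟩ := h
  exact (PPControls.pi fun j => (hg j).ppControls).of_isPureEmbedding
    (isPureEmbedding_of_leftInverse hπ)

variable (I B) in
lemma prodClosed_prodBStar : ProdClosed Rᵐᵒᵖ (ProdBStar (R := R) I B) := by
  intro κ N hN
  choose ι g hg i π hπ using hN
  refine ⟨Σ k, ι k, fun s => g s.1 s.2, fun s => hg s.1 s.2,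
    LinearMap.pi fun s => (LinearMap.proj s.2).comp ((i s.1).comp (LinearMap.proj s.1)),
    LinearMap.pi fun k => (π k).comp (LinearMap.pi fun j => LinearMap.proj (⟨k, j⟩ : Σ k, ι k)), ?_⟩
  exact LinearMap.ext fun x => funext fun k => LinearMap.congr_fun (hπ k) (x k)

variable (R I B) in
lemma prodBStar_character_directSum :
    ProdBStar I B (ModuleCat.of Rᵐᵒᵖ (Character (⨁ i, B i))) := by
  classical
  refine ⟨I, fun i => ModuleCat.of R (B i), fun i => ⟨1, fun _ => i,
    LinearMap.pi fun _ => LinearMap.id, LinearMap.proj 0, rfl⟩,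
    (Character.directSumEquiv B).toLinearMap, (Character.directSumEquiv B).symm.toLinearMap, ?_⟩
  exact LinearMap.ext fun x => (Character.directSumEquiv B).symm_apply_apply x

lemma isPureInjective_of_isDefinable (h : IsDefinable Rᵐᵒᵖ (ProdBStar I B)) (J : Type u) :
    IsPureInjective Rᵐᵒᵖ (⨁ _ : J, Character (⨁ i, B i)) := by
  obtain ⟨hprod, -, hpure⟩ := h
  have h1 := hprod J (fun _ => ModuleCat.of Rᵐᵒᵖ (Character (⨁ i, B i)))
    fun _ => prodBStar_character_directSum R I B
  have h2 := hpure (ModuleCat.of Rᵐᵒᵖ (⨁ _ : J, Character (⨁ i, B i))) _ _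
    (isPureEmbedding_directSumToPi fun _ : J => Character (⨁ i, B i)) h1
  exact h2.isAlgCompact.isPureInjective

lemma isPureInjective_of_isPureEmbedding
    (h : PPDescending Rᵐᵒᵖ (Character (⨁ i, B i))) {N : Type u} [AddCommGroup N] [Module Rᵐᵒᵖ N]
    {X : ModuleCat.{u} Rᵐᵒᵖ} (hX : ProdBStar I B X) {i : N →ₗ[Rᵐᵒᵖ] X}
    (hi : IsPureEmbedding Rᵐᵒᵖ i) : IsPureInjective Rᵐᵒᵖ N :=
  (h.of_ppControls (hX.ppControls.of_isPureEmbedding hi)).isAlgCompact.isPureInjective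

theorem isDefinable_of_ppDescending (h : PPDescending Rᵐᵒᵖ (Character (⨁ i, B i))) :
    IsDefinable Rᵐᵒᵖ (ProdBStar I B) := by
  have hpure : PureSubClosed Rᵐᵒᵖ (ProdBStar I B) := fun N X i hi hX => by
    obtain ⟨π, hπ⟩ := isPureInjective_of_isPureEmbedding h hX hi X i hi
    exact hX.of_isDirectSummand ⟨i, π, hπ⟩
  refine ⟨prodClosed_prodBStar I B, ?_, hpure⟩
  intro ι _ _ _ _ G _ _ f _ hG
  have h1 := prodClosed_prodBStar I B ι (fun i => ModuleCat.of Rᵐᵒᵖ (G i)) hG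
  have h2 : ProdBStar I B (ModuleCat.of Rᵐᵒᵖ (⨁ i, G i)) :=
    hpure _ _ _ (isPureEmbedding_directSumToPi G) h1
  have h3 : IsPureEmbedding Rᵐᵒᵖ (LinearMap.ker (directSumToDirectLimit Rᵐᵒᵖ G f)).subtype :=
    isPureEmbedding_ker_directSumToDirectLimit
  exact h2.of_isDirectSummand (isDirectSummand_of_pure_ker directSumToDirectLimit_surjective
    (isPureInjective_of_isPureEmbedding h h2 h3) h3)

end ProdBStarClosure

theorem ProdBStar_definable_tfae
    {R : Type u} [Ring R] (I : Type u) (B : I → Type u)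
    [∀ i, AddCommGroup (B i)] [∀ i, Module R (B i)]
    (hfp : ∀ i, Module.FinitePresentation R (B i)) :
    List.TFAE
      [ IsDefinable Rᵐᵒᵖ (ProdBStar I B),
        Nonempty (Character (⨁ i, B i) ≃ₗ[Rᵐᵒᵖ] ∀ i, Character (B i)) ∧
          ∀ J : Type u, IsPureInjective Rᵐᵒᵖ (⨁ _ : J, Character (⨁ i, B i)),
        IsNoetherian (Module.End R (⨁ i, B i)) (⨁ i, B i) ] := by
  classical
  tfae_have 1 → 2 := fun h =>
    ⟨⟨Character.directSumEquiv B⟩, fun J => isPureInjective_of_isDefinable h J⟩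
  tfae_have 2 → 3 := fun h => isNoetherian_of_isPureInjective hfp (h.2 _)
  tfae_have 3 → 1 := fun h => isDefinable_of_ppDescending (ppDescending_of_isNoetherian h)
  tfae_finish

end
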